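/- Fix k ≥ 1, p ∈ ℂ, e ∈ ℂ×, and b = (b₁,…,b_{k−1}), g = (g₁,…,g_{k−1}) ∈ ℂ^{k−1}. Then y(p,e,b,g), viewed in GL_{k+1}(K), lies in the matrix slice Gr_ν for ν = (−1,0,…,0,1) ∈ ℤ^{k+1}: there is a unique factorization y(p,e,b,g) = U·h·t^ν·L with U ∈ N₁[[t⁻¹]], h ∈ T₁[[t⁻¹]], L ∈ N₋,₁[[t⁻¹]]. Moreover the coefficients of U satisfy: U^{(1)}_{1,k+1} = e; U^{(1)}_{i,k+1} = b_{k+1−i} for 2 ≤ i ≤ k; U^{(1)}_{1,j} = e·g_{k+1−j} for 2 ≤ j ≤ k; and U^{(2)}_{1,k+1} = e·(p + ∑_{i=1}^{k−1} b_i g_i). Equivalently, Φ(y) = (b₁,…,b_{k−1},e) and ζ(y) = (e g_{k−1}, e g_{k−2}, …, e g₁, e(p + ∑_{i=1}^{k−1} b_i g_i)), where Φ and ζ extract the indicated first and second t⁻¹-coefficients of the entries of U. -/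

import Mathlib

open Matrix

noncomputable section

/-- `K = ℂ((t⁻¹))`, the field of formal Laurent series in `t⁻¹`.  We realize it as
`LaurentSeries ℂ`, where the Laurent-series variable `X` plays the role of `t⁻¹`;
thus for `f : K`, `f.coeff j` is the coefficient of `t^{-j}`. -/
abbrev K : Type := LaurentSeries ℂ

/-- The element `t` (the inverse of the Laurent series variable). -/
def tK : K := (HahnSeries.single (-1 : ℤ) (1 : ℂ))

/-- The constant embedding `ℂ → K`. -/
def Cc (z : ℂ) : K := HahnSeries.C z

/-- `f ∈ 𝒪 = ℂ[[t⁻¹]]` : no positive powers of `t`. -/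
def memO (f : K) : Prop := ∀ j : ℤ, j < 0 → f.coeff j = 0

/-- `f ∈ 𝒪₁ = t⁻¹ℂ[[t⁻¹]]`. -/
def memO1 (f : K) : Prop := ∀ j : ℤ, j ≤ 0 → f.coeff j = 0

/-- `f ∈ ℂ[t]`. -/
def memPoly (f : K) : Prop := ∀ j : ℤ, 0 < j → f.coeff j = 0

/-- Upper unitriangular matrix. -/
def IsUpperUni {R : Type*} [Zero R] [One R] {m : ℕ} (M : Matrix (Fin m) (Fin m) R) : Prop :=
  (∀ i, M i i = 1) ∧ ∀ i j : Fin m, j < i → M i j = 0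

/-- Lower unitriangular matrix. -/
def IsLowerUni {R : Type*} [Zero R] [One R] {m : ℕ} (M : Matrix (Fin m) (Fin m) R) : Prop :=
  (∀ i, M i i = 1) ∧ ∀ i j : Fin m, i < j → M i j = 0

/-- `M ∈ N₁[[t⁻¹]]` : upper unitriangular with off-diagonal entries in `𝒪₁`. -/
def MemN1 {m : ℕ} (M : Matrix (Fin m) (Fin m) K) : Prop :=
  IsUpperUni M ∧ ∀ i j : Fin m, i ≠ j → memO1 (M i j)

/-- `M ∈ N₋,₁[[t⁻¹]]`. -/
def MemN1neg {m : ℕ} (M : Matrix (Fin m) (Fin m) K) : Prop :=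
  IsLowerUni M ∧ ∀ i j : Fin m, i ≠ j → memO1 (M i j)

/-- `M ∈ T₁[[t⁻¹]]` : diagonal with entries in `1 + 𝒪₁`. -/
def MemT1 {m : ℕ} (M : Matrix (Fin m) (Fin m) K) : Prop :=
  (∀ i j : Fin m, i ≠ j → M i j = 0) ∧ ∀ i, memO1 (M i i - 1)

/-- `M ∈ N[t]` : upper unitriangular with entries in `ℂ[t]`. -/
def MemNpoly {m : ℕ} (M : Matrix (Fin m) (Fin m) K) : Prop :=
  IsUpperUni M ∧ ∀ i j : Fin m, memPoly (M i j)

/-- `M ∈ N₋[t]` : lower unitriangular with entries in `ℂ[t]`. -/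
def MemNnegPoly {m : ℕ} (M : Matrix (Fin m) (Fin m) K) : Prop :=
  IsLowerUni M ∧ ∀ i j : Fin m, memPoly (M i j)

/-- `t^ν = diag(t^{ν₁},…,t^{ν_m})`. -/
def tPow {m : ℕ} (ν : Fin m → ℤ) : Matrix (Fin m) (Fin m) K :=
  Matrix.diagonal fun i => tK ^ ν i

/-- `y = u · h · t^ν · l` is a Gauss factorization exhibiting membership in `Gr_ν`. -/
def IsGauss {m : ℕ} (ν : Fin m → ℤ) (y u h l : Matrix (Fin m) (Fin m) K) : Prop :=
  MemN1 u ∧ MemT1 h ∧ MemN1neg l ∧ y = u * h * tPow ν * l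

/-- The matrix slice `Gr_ν = N₁[[t⁻¹]]·T₁[[t⁻¹]]·t^ν·N₋,₁[[t⁻¹]]`. -/
def GrSlice {m : ℕ} (ν : Fin m → ℤ) : Set (Matrix (Fin m) (Fin m) K) :=
  { y | ∃ u h l, IsGauss ν y u h l }

/-- Block embedding `τ_α : Mat_{k+1} → Mat_n` into (1-indexed) rows and columns `r₁,…,r₁+k`,
identity outside this block. -/
def blockEmbed {R : Type*} [Zero R] [One R] (n r₁ k : ℕ)
    (g : Matrix (Fin (k+1)) (Fin (k+1)) R) : Matrix (Fin n) (Fin n) R :=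
  fun i j =>
    if h : r₁ - 1 ≤ (i : ℕ) ∧ (i : ℕ) ≤ r₁ - 1 + k ∧ r₁ - 1 ≤ (j : ℕ) ∧ (j : ℕ) ≤ r₁ - 1 + k then
      g ⟨(i : ℕ) - (r₁ - 1), by omega⟩ ⟨(j : ℕ) - (r₁ - 1), by omega⟩
    else if i = j then 1 else 0

/-- The coweight `α` of `PGL_n` : `α_{r₁} = 1`, `α_{r₂+1} = -1` (1-indexed), all other
entries `0`. -/
def alphaCo (n r₁ r₂ : ℕ) : Fin n → ℤ :=
  fun i => if (i : ℕ) = r₁ - 1 then 1 else if (i : ℕ) = r₂ then -1 else 0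

/-- The matrix `y(p,e,b,g)` (matrix representative of a point of the open Zastava
`Gr⁰_{-α}`), a `(k+1)×(k+1)` matrix over `ℂ[t] ⊆ K`. -/
def ymat (k : ℕ) (p e : ℂ) (b g : Fin (k-1) → ℂ) :
    Matrix (Fin (k+1)) (Fin (k+1)) K :=
  fun i j =>
    if _hi0 : (i : ℕ) = 0 then
      (if _hjk : (j : ℕ) = k then Cc e else 0)
    else if _hik : (i : ℕ) = k then
      (if _hj0 : (j : ℕ) = 0 then Cc (-e⁻¹)
       else if _hjk : (j : ℕ) = k then tK - Cc (p + ∑ l : Fin (k-1), b l * g l)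
       else Cc (-(g ⟨k - (j : ℕ) - 1, by have := j.isLt; omega⟩)))
    else
      (if _hji : (j : ℕ) = (i : ℕ) then 1
       else if _hjk : (j : ℕ) = k then Cc (b ⟨k - (i : ℕ) - 1, by have := i.isLt; omega⟩)
       else 0)

/-- The matrix `x₋(v)` over `K` : identity except for the bottom row `(v_k,…,v₁,1)`. -/
def xminusK (k : ℕ) (v : Fin k → ℂ) : Matrix (Fin (k+1)) (Fin (k+1)) K :=
  fun i j =>
    if _hik : (i : ℕ) = k then
      (if _hjk : (j : ℕ) = k then 1 else Cc (v ⟨k - (j : ℕ) - 1, by have := j.isLt; omega⟩))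
    else if i = j then 1 else 0

/-- `Φ_α(y)` read off from the `N₁[[t⁻¹]]`-factor `u` of a Gauss factorization of `y`. -/
def PhiOf (n r₂ k : ℕ) (hrn : r₂ < n) (u : Matrix (Fin n) (Fin n) K) : Fin k → ℂ :=
  fun a => (u ⟨r₂ - 1 - (a : ℕ), by omega⟩ ⟨r₂, hrn⟩).coeff 1

/-- `ζ_α(y)` read off from the `N₁[[t⁻¹]]`-factor `u` of a Gauss factorization of `y`. -/
def ZetaOf (n r₁ r₂ k : ℕ) (hr1 : 1 ≤ r₁) (hrr : r₁ ≤ r₂) (hrn : r₂ < n)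
    (hk : k = r₂ - r₁ + 1) (u : Matrix (Fin n) (Fin n) K) : Fin k → ℂ :=
  fun a =>
    if _ha : (a : ℕ) = k - 1 then (u ⟨r₁ - 1, by omega⟩ ⟨r₂, hrn⟩).coeff 2
    else (u ⟨r₁ - 1, by omega⟩ ⟨r₁ + (a : ℕ), by have := a.isLt; omega⟩).coeff 1

/-- `ξ_α(y)`, computed from the `N₁[[t⁻¹]]`-factor `u` of a Gauss factorization of `y`. -/
def xiOf (n r₁ r₂ k : ℕ) (hr1 : 1 ≤ r₁) (hrr : r₁ ≤ r₂) (hrn : r₂ < n)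
    (hk : k = r₂ - r₁ + 1) (u : Matrix (Fin n) (Fin n) K) : Matrix (Fin n) (Fin n) K :=
  let c := PhiOf n r₂ k hrn u
  let z := ZetaOf n r₁ r₂ k hr1 hrr hrn hk u
  let e : ℂ := c ⟨k - 1, by omega⟩
  let b : Fin (k-1) → ℂ := fun i => c ⟨(i : ℕ), by have := i.isLt; omega⟩
  let g : Fin (k-1) → ℂ := fun i => z ⟨k - (i : ℕ) - 2, by omega⟩ / e
  let p : ℂ := z ⟨k - 1, by omega⟩ / e - ∑ i : Fin (k-1), b i * g i
  blockEmbed n r₁ k (ymat k p e b g)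

/-- `M` has identity submatrix in (1-indexed) rows and columns `r₁,…,r₁+k`. -/
def HasIdBlock {R : Type*} [Zero R] [One R] {n : ℕ} (r₁ k : ℕ)
    (M : Matrix (Fin n) (Fin n) R) : Prop :=
  ∀ i j : Fin n, r₁ - 1 ≤ (i : ℕ) → (i : ℕ) ≤ r₁ - 1 + k →
    r₁ - 1 ≤ (j : ℕ) → (j : ℕ) ≤ r₁ - 1 + k →
    M i j = if i = j then 1 else 0

/-- `M ∈ N^α(K)` : upper unitriangular over `K` with identity `(k+1)×(k+1)`-block. -/
def MemNalphaK (n r₁ k : ℕ) (M : Matrix (Fin n) (Fin n) K) : Prop :=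
  IsUpperUni M ∧ HasIdBlock r₁ k M

/-- `M ∈ N^α[t]`. -/
def MemNalphaPoly (n r₁ k : ℕ) (M : Matrix (Fin n) (Fin n) K) : Prop :=
  MemNalphaK n r₁ k M ∧ ∀ i j : Fin n, memPoly (M i j)

/-- `M ∈ N(K)^α₁ = x_α(N_{1,k+1}[[t⁻¹]])·N^α(K)`. -/
def MemNKalpha1 (n r₁ k : ℕ) (M : Matrix (Fin n) (Fin n) K) : Prop :=
  ∃ (a : Matrix (Fin (k+1)) (Fin (k+1)) K) (u : Matrix (Fin n) (Fin n) K),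
    MemN1 a ∧ MemNalphaK n r₁ k u ∧ M = blockEmbed n r₁ k a * u

/-- `z = π(x)` for the slice `Gr_ν` : `z ∈ Gr_ν` and `z = a·x·b` with `a ∈ N[t]`,
`b ∈ N₋[t]`. -/
def IsPiOf {n : ℕ} (ν : Fin n → ℤ) (x z : Matrix (Fin n) (Fin n) K) : Prop :=
  z ∈ GrSlice ν ∧ ∃ a b, MemNpoly a ∧ MemNnegPoly b ∧ z = a * x * b

/-- The open Zastava slice `Gr⁰_{-α} ⊆ GL_n(K)` : matrices `τ_α(y(p,e,b,g))`. -/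
def GrZeroNegAlpha (n r₁ k : ℕ) : Set (Matrix (Fin n) (Fin n) K) :=
  { M | ∃ (p e : ℂ) (b g : Fin (k-1) → ℂ), e ≠ 0 ∧ M = blockEmbed n r₁ k (ymat k p e b g) }

/-- `μ + α`. -/
def addAlpha (n r₁ r₂ : ℕ) (μ : Fin n → ℤ) : Fin n → ℤ :=
  fun i => μ i + alphaCo n r₁ r₂ i


/-- The coweight `ν = (−1,0,…,0,1) ∈ ℤ^{k+1}`. -/
def nuAnti (k : ℕ) : Fin (k+1) → ℤ :=
  fun i => if (i : ℕ) = 0 then -1 else if (i : ℕ) = k then 1 else 0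

/-- Partial sums of the entries of a product of rank-one-type triangular matrices. -/
theorem sum_range_gauss {F : Type*} [Field F] (k : ℕ) (x y D : ℕ → F) (hD : ∀ m, D m ≠ 0)
    (hx0 : x 0 * y 0 = 1) (hrec : ∀ m, 1 ≤ m → m < k → D m = D (m + 1) + x m * y m)
    (i j n : ℕ) (hn : n ≤ k) :
    ∑ m ∈ Finset.range n,
      (if i = m then 1 else if i < m then x i * y m * (D m)⁻¹ else 0) *
        ((if m = 0 then (D 1)⁻¹ else if m = k then D k else D m / D (m + 1)) *
          (if m = j then 1 else if j < m then x m * y j * (D m)⁻¹ else 0)) =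
      if i < n ∧ j < n then (if i = j ∧ i ≠ 0 then 1 else 0) + x i * y j * (D n)⁻¹ else 0 := by
  induction n with
  | zero => simp
  | succ n ih =>
    rw [Finset.sum_range_succ, ih (by omega)]
    have h1 := hD n
    have h2 := hD (n + 1)
    have hnk : n ≠ k := by omega
    rcases Nat.eq_zero_or_pos n with rfl | hpos
    · rcases Nat.eq_zero_or_pos i with rfl | hi
      · rcases Nat.eq_zero_or_pos j with rfl | hj
        · simp [hx0]
        · simp [hj.ne', hj.ne]
      · simp [hi.ne']
    · have h3 := hrec n hpos (by omega)
      rcases lt_trichotomy i n with hi | rfl | hi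
      · rcases lt_trichotomy j n with hj | rfl | hj
        · rw [if_pos ⟨hi, hj⟩, if_neg hi.ne, if_pos hi, if_neg hpos.ne', if_neg hnk,
            if_neg hj.ne', if_pos hj, if_pos (show i < n + 1 ∧ j < n + 1 by omega)]
          field_simp
          rw [h3]
          ring
        · rw [if_neg (by omega), if_neg hi.ne, if_pos hi, if_neg hpos.ne', if_neg hnk,
            if_pos rfl, if_pos (show i < j + 1 ∧ j < j + 1 by omega), if_neg (by omega)]
          field_simp
        · rw [if_neg (by omega), if_neg hj.ne, if_neg (by omega : ¬ j < n),
            if_neg (by omega : ¬ (i < n + 1 ∧ j < n + 1))]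
          simp
      · rcases lt_trichotomy j i with hj | rfl | hj
        · rw [if_neg (by omega), if_pos rfl, if_neg hpos.ne', if_neg hnk,
            if_neg hj.ne', if_pos hj, if_pos (show i < i + 1 ∧ j < i + 1 by omega),
            if_neg (by omega)]
          field_simp
        · rw [if_neg (by omega), if_pos rfl, if_neg hpos.ne', if_neg hnk,
            if_pos (show j < j + 1 ∧ j < j + 1 by omega), if_pos ⟨rfl, by omega⟩]
          field_simp
          rw [h3]
          ring
        · rw [if_neg (by omega), if_neg hj.ne, if_neg (by omega : ¬ j < i),
            if_neg (by omega : ¬ (i < i + 1 ∧ j < i + 1))]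
          simp
      · rw [if_neg (by omega), if_neg hi.ne', if_neg (by omega : ¬ i < n),
          if_neg (by omega : ¬ (i < n + 1 ∧ j < n + 1))]
        simp

theorem Cc_mul (z w : ℂ) : Cc (z * w) = Cc z * Cc w := map_mul HahnSeries.C z w

theorem Cc_one : Cc 1 = 1 := map_one HahnSeries.C

theorem Cc_neg (z : ℂ) : Cc (-z) = -Cc z := map_neg HahnSeries.C z

theorem Cc_zero : Cc 0 = 0 := map_zero HahnSeries.C

theorem Cc_sub (z w : ℂ) : Cc (z - w) = Cc z - Cc w := map_sub HahnSeries.C z w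

theorem coeff_Cc_mul (z : ℂ) (f : K) (j : ℤ) : (Cc z * f).coeff j = z * f.coeff j := by
  rw [Cc, HahnSeries.C_mul_eq_smul, HahnSeries.coeff_smul, smul_eq_mul]

theorem tK_sub_Cc_ne_zero (c : ℂ) : tK - Cc c ≠ 0 := by
  intro h
  have := congrArg (fun f : K => f.coeff (-1)) h
  simp [tK, Cc, HahnSeries.C_apply] at this

/-- The coefficients of `(t - c)⁻¹` satisfy a geometric recurrence. -/
theorem coeff_inv_tK_sub_Cc_succ (c : ℂ) (j : ℤ) :
    ((tK - Cc c)⁻¹ : K).coeff (j + 1) =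
      c * ((tK - Cc c)⁻¹ : K).coeff j + if j = 0 then 1 else 0 := by
  have h := congrArg (fun f : K => f.coeff j) (mul_inv_cancel₀ (tK_sub_Cc_ne_zero c))
  simp only [sub_mul, HahnSeries.coeff_sub, coeff_Cc_mul, HahnSeries.coeff_one] at h
  rw [tK, HahnSeries.coeff_single_mul, one_mul, sub_neg_eq_add] at h
  rw [← tK] at h
  split_ifs at h ⊢ <;> linear_combination h

theorem memO1_inv_tK_sub_Cc (c : ℂ) : memO1 (tK - Cc c)⁻¹ := by
  set f : K := (tK - Cc c)⁻¹ with hf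
  have key : ∀ n : ℕ, f.order - 1 + n ≤ 0 → f.coeff (f.order - 1 + n) = 0 := by
    intro n
    induction n with
    | zero => intro _; exact HahnSeries.coeff_eq_zero_of_lt_order (by simp)
    | succ n ih =>
      intro hn
      push_cast at hn ⊢
      rw [← add_assoc, hf, coeff_inv_tK_sub_Cc_succ, ← hf, ih (by omega), if_neg (by omega)]
      simp
  intro j hj
  rcases lt_or_ge j f.order with h | h
  · exact HahnSeries.coeff_eq_zero_of_lt_order h
  · have := key (j - (f.order - 1)).toNat
    rw [Int.toNat_of_nonneg (by omega), add_sub_cancel] at this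
    exact this hj

theorem coeff_one_inv_tK_sub_Cc (c : ℂ) : ((tK - Cc c)⁻¹ : K).coeff 1 = 1 := by
  simpa [memO1_inv_tK_sub_Cc c 0 le_rfl] using coeff_inv_tK_sub_Cc_succ c 0

theorem coeff_two_inv_tK_sub_Cc (c : ℂ) : ((tK - Cc c)⁻¹ : K).coeff 2 = c := by
  have h := coeff_inv_tK_sub_Cc_succ c 1
  rw [coeff_one_inv_tK_sub_Cc] at h
  simpa using h

theorem memO1.Cc_mul {f : K} (hf : memO1 f) (z : ℂ) : memO1 (Cc z * f) := fun j hj => by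
  rw [coeff_Cc_mul, hf j hj, mul_zero]

theorem memO1_zero : memO1 0 := fun _ _ => rfl

/-- `(t - c) / (t - d) ∈ 1 + 𝒪₁`. -/
theorem memO1_div_sub_one (c d : ℂ) : memO1 ((tK - Cc c) / (tK - Cc d) - 1) := by
  have h : (tK - Cc c) / (tK - Cc d) - 1 = Cc (d - c) * (tK - Cc d)⁻¹ := by
    have := tK_sub_Cc_ne_zero d
    rw [Cc_sub]
    field_simp
    ring
  rw [h]
  exact (memO1_inv_tK_sub_Cc d).Cc_mul _

theorem tK_ne_zero : tK ≠ 0 := by simpa [Cc_zero] using tK_sub_Cc_ne_zero 0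

theorem ne_zero_of_memO1_sub_one {f : K} (hf : memO1 (f - 1)) : f ≠ 0 := by
  rintro rfl
  simpa using hf 0 le_rfl

section Triangular

variable {R : Type*} [CommRing R] {m : ℕ}

theorem IsLowerUni.transpose {M : Matrix (Fin m) (Fin m) R} (h : IsLowerUni M) :
    IsUpperUni Mᵀ := ⟨h.1, fun i j hij => h.2 j i hij⟩

theorem IsUpperUni.mul_apply_self {M N : Matrix (Fin m) (Fin m) R} (hM : IsUpperUni M)
    (hN : N.BlockTriangular id) (i : Fin m) : (M * N) i i = N i i := by
  rw [Matrix.mul_apply, Finset.sum_eq_single i]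
  · rw [hM.1, one_mul]
  · intro j _ hj
    rcases lt_or_gt_of_ne hj with h | h
    · rw [hM.2 i j h, zero_mul]
    · rw [hN h, mul_zero]
  · simp

theorem IsUpperUni.isUnit_det {M : Matrix (Fin m) (Fin m) R} (hM : IsUpperUni M) :
    IsUnit M.det := by
  rw [Matrix.det_of_isUpperTriangular (fun i j h => hM.2 i j h)]
  simp [hM.1]

/-- `A⁻¹ * B` is upper unitriangular when `A` and `B` are. -/
theorem IsUpperUni.inv_mul {A B : Matrix (Fin m) (Fin m) R} (hA : IsUpperUni A)
    (hB : IsUpperUni B) : IsUpperUni (A⁻¹ * B) := by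
  have := Matrix.invertibleOfIsUnitDet A hA.isUnit_det
  have hA' : A.BlockTriangular id := fun i j h => hA.2 i j h
  have hB' : B.BlockTriangular id := fun i j h => hB.2 i j h
  have hX : (A⁻¹ * B).BlockTriangular id :=
    (Matrix.blockTriangular_inv_of_blockTriangular hA').mul hB'
  refine ⟨fun i => ?_, fun i j h => hX h⟩
  rw [← hA.mul_apply_self hX, Matrix.mul_nonsing_inv_cancel_left _ _ hA.isUnit_det, hB.1]

/-- `A * B⁻¹` is lower unitriangular when `A` and `B` are. -/
theorem IsLowerUni.mul_inv {A B : Matrix (Fin m) (Fin m) R} (hA : IsLowerUni A)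
    (hB : IsLowerUni B) : IsLowerUni (A * B⁻¹) := by
  have h := hB.transpose.inv_mul hA.transpose
  rw [← Matrix.transpose_nonsing_inv, ← Matrix.transpose_mul] at h
  exact ⟨h.1, fun i j hij => h.2 j i hij⟩

/-- Uniqueness of the Gauss decomposition. -/
theorem gauss_unique {F : Type*} [Field F] {U U' L L' : Matrix (Fin m) (Fin m) F}
    {d d' : Fin m → F} (hU : IsUpperUni U) (hU' : IsUpperUni U') (hL : IsLowerUni L)
    (hL' : IsLowerUni L') (hd : ∀ i, d i ≠ 0)
    (h : U * Matrix.diagonal d * L = U' * Matrix.diagonal d' * L') :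
    U = U' ∧ d = d' ∧ L = L' := by
  have hX := hU'.inv_mul hU
  have hY := hL'.mul_inv hL
  have hLdet : IsUnit L.det := by
    rw [← Matrix.det_transpose]; exact hL.transpose.isUnit_det
  have key : (U'⁻¹ * U) * Matrix.diagonal d = Matrix.diagonal d' * (L' * L⁻¹) := by
    calc (U'⁻¹ * U) * Matrix.diagonal d
        = U'⁻¹ * (U * Matrix.diagonal d * L) * L⁻¹ := by
          simp only [Matrix.mul_assoc, Matrix.mul_nonsing_inv _ hLdet, Matrix.mul_one]
      _ = _ := by
          rw [h]
          simp only [← Matrix.mul_assoc, Matrix.nonsing_inv_mul _ hU'.isUnit_det, Matrix.one_mul]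
  have entry : ∀ i j, (U'⁻¹ * U) i j * d j = d' i * (L' * L⁻¹) i j := fun i j => by
    simpa only [Matrix.mul_diagonal, Matrix.diagonal_mul] using congrFun (congrFun key i) j
  have hdd : d = d' := by
    funext i
    simpa [hX.1, hY.1] using entry i i
  subst hdd
  have hX1 : U'⁻¹ * U = 1 := by
    ext i j
    rcases lt_trichotomy i j with hij | rfl | hij
    · have := entry i j
      rw [hY.2 i j hij, mul_zero] at this
      rw [Matrix.one_apply_ne hij.ne]
      exact (mul_eq_zero.mp this).resolve_right (hd j)
    · rw [hX.1, Matrix.one_apply_eq]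
    · rw [hX.2 i j hij, Matrix.one_apply_ne hij.ne']
  have hY1 : L' * L⁻¹ = 1 := by
    ext i j
    rcases lt_trichotomy i j with hij | rfl | hij
    · rw [hY.2 i j hij, Matrix.one_apply_ne hij.ne]
    · rw [hY.1, Matrix.one_apply_eq]
    · have := entry i j
      rw [hX.2 i j hij, zero_mul] at this
      rw [Matrix.one_apply_ne hij.ne']
      exact (mul_eq_zero.mp this.symm).resolve_left (hd i)
  refine ⟨?_, rfl, ?_⟩
  · rw [← Matrix.mul_nonsing_inv_cancel_left U' U hU'.isUnit_det, hX1, Matrix.mul_one]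
  · rw [← Matrix.nonsing_inv_mul_cancel_right L L' hLdet, hY1, Matrix.one_mul]

end Triangular

theorem MemT1.eq_diagonal {m : ℕ} {h : Matrix (Fin m) (Fin m) K} (hh : MemT1 h) :
    h = Matrix.diagonal fun i => h i i := by
  ext i j
  rcases eq_or_ne i j with rfl | hij
  · simp
  · rw [hh.1 i j hij, Matrix.diagonal_apply_ne _ hij]

/-- A matrix over `K` has at most one factorization in `N₁ T₁ t^ν N₋,₁`. -/
theorem IsGauss.unique {m : ℕ} {ν : Fin m → ℤ} {y u h l u' h' l' : Matrix (Fin m) (Fin m) K}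
    (H : IsGauss ν y u h l) (H' : IsGauss ν y u' h' l') : u = u' ∧ h = h' ∧ l = l' := by
  obtain ⟨hu, hh, hl, hy⟩ := H
  obtain ⟨hu', hh', hl', hy'⟩ := H'
  have ht : ∀ i, tK ^ ν i ≠ 0 := fun i => zpow_ne_zero _ tK_ne_zero
  have hE := hy.symm.trans hy'
  rw [hh.eq_diagonal, hh'.eq_diagonal, tPow, Matrix.mul_assoc u, Matrix.mul_assoc u',
    Matrix.diagonal_mul_diagonal, Matrix.diagonal_mul_diagonal] at hE
  obtain ⟨h1, h2, h3⟩ := gauss_unique hu.1 hu'.1 hl.1 hl'.1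
    (fun i => mul_ne_zero (ne_zero_of_memO1_sub_one (hh.2 i)) (ht i)) hE
  refine ⟨h1, ?_, h3⟩
  rw [hh.eq_diagonal, hh'.eq_diagonal]
  congr 1
  funext i
  exact mul_right_cancel₀ (ht i) (congrFun h2 i)

/-- The column coordinates `(e, b_{k-1}, …, b₁, -1)` of `y(p,e,b,g)`. -/
def colSeq (k : ℕ) (e : ℂ) (b : Fin (k-1) → ℂ) (i : ℕ) : ℂ :=
  if _h0 : i = 0 then e else if h : i < k then b ⟨k - i - 1, by omega⟩ else -1

/-- The row coordinates `(e⁻¹, g_{k-1}, …, g₁, 1)` of `y(p,e,b,g)`. -/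
def rowSeq (k : ℕ) (e : ℂ) (g : Fin (k-1) → ℂ) (i : ℕ) : ℂ :=
  if _h0 : i = 0 then e⁻¹ else if h : i < k then g ⟨k - i - 1, by omega⟩ else 1

/-- The lower right principal minors of `y(p,e,b,g)` are `t - minorRoot`. -/
def minorRoot (k : ℕ) (p e : ℂ) (b g : Fin (k-1) → ℂ) (m : ℕ) : ℂ :=
  p + ∑ l : Fin (k-1), b l * g l - ∑ l ∈ Finset.Ico m k, colSeq k e b l * rowSeq k e g l

/-- The factor of `y(p,e,b,g)` in `N₁[[t⁻¹]]`. -/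
def ymatU (k : ℕ) (p e : ℂ) (b g : Fin (k-1) → ℂ) : Matrix (Fin (k+1)) (Fin (k+1)) K :=
  fun i j => if (i : ℕ) = j then 1 else if (i : ℕ) < j then
    Cc (colSeq k e b i) * Cc (rowSeq k e g j) * (tK - Cc (minorRoot k p e b g j))⁻¹ else 0

/-- The factor of `y(p,e,b,g)` in `N₋,₁[[t⁻¹]]`. -/
def ymatL (k : ℕ) (p e : ℂ) (b g : Fin (k-1) → ℂ) : Matrix (Fin (k+1)) (Fin (k+1)) K :=
  fun i j => if (i : ℕ) = j then 1 else if (j : ℕ) < i then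
    Cc (colSeq k e b i) * Cc (rowSeq k e g j) * (tK - Cc (minorRoot k p e b g i))⁻¹ else 0

/-- The factor of `y(p,e,b,g)` in `T₁[[t⁻¹]]`. -/
def ymatH (k : ℕ) (p e : ℂ) (b g : Fin (k-1) → ℂ) : Matrix (Fin (k+1)) (Fin (k+1)) K :=
  Matrix.diagonal fun i =>
    if (i : ℕ) = 0 then (tK - Cc 0) / (tK - Cc (minorRoot k p e b g 1))
    else if (i : ℕ) = k then (tK - Cc (minorRoot k p e b g k)) / (tK - Cc 0)
    else (tK - Cc (minorRoot k p e b g i)) / (tK - Cc (minorRoot k p e b g (i + 1)))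

theorem memN1_ymatU (k : ℕ) (p e : ℂ) (b g : Fin (k-1) → ℂ) : MemN1 (ymatU k p e b g) := by
  refine ⟨⟨fun i => if_pos rfl, fun i j hij => ?_⟩, fun i j hij => ?_⟩
  · rw [Fin.lt_def] at hij
    rw [ymatU, if_neg (by omega), if_neg (by omega)]
  · rw [ymatU, if_neg (Fin.val_ne_of_ne hij)]
    split_ifs
    · rw [← Cc_mul]; exact (memO1_inv_tK_sub_Cc _).Cc_mul _
    · exact memO1_zero

theorem memN1neg_ymatL (k : ℕ) (p e : ℂ) (b g : Fin (k-1) → ℂ) :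
    MemN1neg (ymatL k p e b g) := by
  refine ⟨⟨fun i => if_pos rfl, fun i j hij => ?_⟩, fun i j hij => ?_⟩
  · rw [Fin.lt_def] at hij
    rw [ymatL, if_neg (by omega), if_neg (by omega)]
  · rw [ymatL, if_neg (Fin.val_ne_of_ne hij)]
    split_ifs
    · rw [← Cc_mul]; exact (memO1_inv_tK_sub_Cc _).Cc_mul _
    · exact memO1_zero

theorem memT1_ymatH (k : ℕ) (p e : ℂ) (b g : Fin (k-1) → ℂ) : MemT1 (ymatH k p e b g) := by
  refine ⟨fun i j hij => Matrix.diagonal_apply_ne _ hij, fun i => ?_⟩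
  rw [ymatH, Matrix.diagonal_apply_eq]
  split_ifs <;> exact memO1_div_sub_one _ _

theorem ymatH_mul_tPow (k : ℕ) (p e : ℂ) (b g : Fin (k-1) → ℂ) :
    ymatH k p e b g * tPow (nuAnti k) = Matrix.diagonal fun i : Fin (k + 1) =>
      if (i : ℕ) = 0 then (tK - Cc (minorRoot k p e b g 1))⁻¹
      else if (i : ℕ) = k then tK - Cc (minorRoot k p e b g k)
      else (tK - Cc (minorRoot k p e b g i)) / (tK - Cc (minorRoot k p e b g (i + 1))) := by
  rw [ymatH, tPow, Matrix.diagonal_mul_diagonal]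
  congr 1
  funext i
  have ht := tK_ne_zero
  rw [nuAnti, Cc_zero, sub_zero]
  split_ifs with h1 h2
  · rw [_root_.zpow_neg_one, div_eq_mul_inv, mul_right_comm, mul_inv_cancel₀ ht, one_mul]
  · rw [_root_.zpow_one, div_mul_cancel₀ _ ht]
  · rw [_root_.zpow_zero, mul_one]

theorem minorRoot_self (k : ℕ) (p e : ℂ) (b g : Fin (k-1) → ℂ) :
    minorRoot k p e b g k = p + ∑ l : Fin (k-1), b l * g l := by
  simp [minorRoot]

theorem minorRoot_succ (k : ℕ) (p e : ℂ) (b g : Fin (k-1) → ℂ) {m : ℕ} (hm : m < k) :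
    minorRoot k p e b g (m + 1) =
      minorRoot k p e b g m + colSeq k e b m * rowSeq k e g m := by
  rw [minorRoot, minorRoot, Finset.sum_eq_sum_Ico_succ_bot hm]
  ring

theorem isGauss_ymat (k : ℕ) (hk : 1 ≤ k) (p e : ℂ) (he : e ≠ 0) (b g : Fin (k-1) → ℂ) :
    IsGauss (nuAnti k) (ymat k p e b g) (ymatU k p e b g) (ymatH k p e b g)
      (ymatL k p e b g) := by
  refine ⟨memN1_ymatU .., memT1_ymatH .., memN1neg_ymatL .., ?_⟩
  rw [Matrix.mul_assoc (ymatU k p e b g), ymatH_mul_tPow k, Matrix.mul_assoc]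
  ext1 i j
  rw [Matrix.mul_apply]
  simp only [Matrix.diagonal_mul, ymatU, ymatL]
  have hsum := Fin.sum_univ_eq_sum_range (fun m : ℕ =>
      (if (i : ℕ) = m then 1 else if (i : ℕ) < m then
        Cc (colSeq k e b i) * Cc (rowSeq k e g m) * (tK - Cc (minorRoot k p e b g m))⁻¹ else 0) *
      ((if m = 0 then (tK - Cc (minorRoot k p e b g 1))⁻¹
        else if m = k then tK - Cc (minorRoot k p e b g k)
        else (tK - Cc (minorRoot k p e b g m)) / (tK - Cc (minorRoot k p e b g (m + 1)))) *
      (if m = (j : ℕ) then 1 else if (j : ℕ) < m then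
        Cc (colSeq k e b m) * Cc (rowSeq k e g j) * (tK - Cc (minorRoot k p e b g m))⁻¹ else 0)))
      (k + 1)
  refine Eq.trans ?_ hsum.symm
  have hx0 : Cc (colSeq k e b 0) * Cc (rowSeq k e g 0) = 1 := by
    rw [← Cc_mul, colSeq, rowSeq, dif_pos rfl, dif_pos rfl, mul_inv_cancel₀ he, Cc_one]
  have hxk : Cc (colSeq k e b k) = -1 := by
    rw [colSeq, dif_neg (by omega), dif_neg (lt_irrefl k), Cc_neg, Cc_one]
  have hyk : Cc (rowSeq k e g k) = 1 := by
    rw [rowSeq, dif_neg (by omega), dif_neg (lt_irrefl k), Cc_one]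
  have hpart := sum_range_gauss k (fun m => Cc (colSeq k e b m)) (fun m => Cc (rowSeq k e g m))
    (fun m => tK - Cc (minorRoot k p e b g m)) (fun m => tK_sub_Cc_ne_zero _) hx0
    (fun m _ hm => by
      simp only [minorRoot_succ k p e b g hm, ← Cc_mul]
      rw [show minorRoot k p e b g m = (minorRoot k p e b g m +
        colSeq k e b m * rowSeq k e g m) - colSeq k e b m * rowSeq k e g m by ring, Cc_sub]
      ring_nf) i j k le_rfl
  rw [Finset.sum_range_succ, hpart]
  have hDk := tK_sub_Cc_ne_zero (minorRoot k p e b g k)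
  have hk0 : k ≠ 0 := by omega
  have hi := i.isLt
  have hj := j.isLt
  rw [if_neg hk0, if_pos rfl, hxk, hyk]
  rcases Nat.lt_succ_iff_lt_or_eq.mp hi with hik | hik
  · rcases Nat.lt_succ_iff_lt_or_eq.mp hj with hjk | hjk
    · rw [if_pos ⟨hik, hjk⟩, if_neg hik.ne, if_pos hik, if_neg hjk.ne', if_pos hjk]
      have hy : ymat k p e b g i j = if (i : ℕ) = j ∧ (i : ℕ) ≠ 0 then 1 else 0 := by
        simp only [ymat]
        split_ifs <;> first | rfl | omega
      rw [hy]
      field_simp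
      ring
    · rw [if_neg (by omega), if_neg hik.ne, if_pos hik, if_pos hjk.symm]
      have hy : ymat k p e b g i j = Cc (colSeq k e b i) := by
        simp only [ymat, colSeq]
        split_ifs <;> first | rfl | omega
      rw [hy]
      field_simp
      ring
  · rcases Nat.lt_succ_iff_lt_or_eq.mp hj with hjk | hjk
    · rw [if_neg (by omega), if_pos hik, if_neg hjk.ne', if_pos hjk]
      have hy : ymat k p e b g i j = -Cc (rowSeq k e g j) := by
        rw [← Cc_neg]
        simp only [ymat, rowSeq]
        split_ifs <;> first | rfl | omega
      rw [hy]
      field_simp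
      ring
    · rw [if_neg (by omega), if_pos hik, if_pos hjk.symm, minorRoot_self]
      have hy : ymat k p e b g i j = tK - Cc (p + ∑ l : Fin (k-1), b l * g l) := by
        simp only [ymat]
        split_ifs <;> first | rfl | omega
      rw [hy]
      ring

theorem ymatU_coeff_one (k : ℕ) (p e : ℂ) (b g : Fin (k-1) → ℂ) {i j : Fin (k+1)}
    (hij : (i : ℕ) < j) :
    (ymatU k p e b g i j).coeff 1 = colSeq k e b i * rowSeq k e g j := by
  rw [ymatU, if_neg hij.ne, if_pos hij, ← Cc_mul, coeff_Cc_mul, coeff_one_inv_tK_sub_Cc, mul_one]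

theorem ymatU_coeff_two (k : ℕ) (p e : ℂ) (b g : Fin (k-1) → ℂ) {i j : Fin (k+1)}
    (hij : (i : ℕ) < j) :
    (ymatU k p e b g i j).coeff 2 =
      colSeq k e b i * rowSeq k e g j * minorRoot k p e b g j := by
  rw [ymatU, if_neg hij.ne, if_pos hij, ← Cc_mul, coeff_Cc_mul, coeff_two_inv_tK_sub_Cc]

/-- `y(p,e,b,g)` lies in the matrix slice `Gr_ν` for
`ν = (−1,0,…,0,1)` : it has a unique factorization `y = U·h·t^ν·L` with
`U ∈ N₁[[t⁻¹]]`, `h ∈ T₁[[t⁻¹]]`, `L ∈ N₋,₁[[t⁻¹]]`, and the `t⁻¹`-coefficients of `U`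
recover the coordinates `(p,e,b,g)` (equivalently, `Φ(y) = (b₁,…,b_{k−1},e)` and
`ζ(y) = (e g_{k−1},…,e g₁, e(p + ∑ b_i g_i))`). -/
theorem statement4 (k : ℕ) (hk : 1 ≤ k) (p e : ℂ) (he : e ≠ 0)
    (b g : Fin (k-1) → ℂ) :
    (∃! UhL : Matrix (Fin (k+1)) (Fin (k+1)) K × Matrix (Fin (k+1)) (Fin (k+1)) K ×
        Matrix (Fin (k+1)) (Fin (k+1)) K,
      IsGauss (nuAnti k) (ymat k p e b g) UhL.1 UhL.2.1 UhL.2.2) ∧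
    (∀ U h L : Matrix (Fin (k+1)) (Fin (k+1)) K,
      IsGauss (nuAnti k) (ymat k p e b g) U h L →
      (U ⟨0, by omega⟩ ⟨k, by omega⟩).coeff 1 = e ∧
      (∀ (i : Fin (k+1)) (hi1 : 1 ≤ (i : ℕ)) (hi2 : (i : ℕ) ≤ k - 1),
        (U i ⟨k, by omega⟩).coeff 1 = b ⟨k - (i : ℕ) - 1, by omega⟩) ∧
      (∀ (j : Fin (k+1)) (hj1 : 1 ≤ (j : ℕ)) (hj2 : (j : ℕ) ≤ k - 1),
        (U ⟨0, by omega⟩ j).coeff 1 = e * g ⟨k - (j : ℕ) - 1, by omega⟩) ∧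
      (U ⟨0, by omega⟩ ⟨k, by omega⟩).coeff 2
        = e * (p + ∑ i : Fin (k-1), b i * g i)) := by
  have hG := isGauss_ymat k hk p e he b g
  refine ⟨⟨(ymatU k p e b g, ymatH k p e b g, ymatL k p e b g), hG, ?_⟩, ?_⟩
  · rintro ⟨U, h, L⟩ H
    obtain ⟨rfl, rfl, rfl⟩ := IsGauss.unique H hG
    rfl
  · intro U h L H
    obtain ⟨rfl, -, -⟩ := IsGauss.unique H hG
    have hx0 : colSeq k e b 0 = e := dif_pos rfl
    have hyk : rowSeq k e g k = 1 := by
      rw [rowSeq, dif_neg (by omega), dif_neg (lt_irrefl k)]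
    refine ⟨?_, fun i hi1 hi2 => ?_, fun j hj1 hj2 => ?_, ?_⟩
    · rw [ymatU_coeff_one k p e b g (show 0 < k from hk), hx0, hyk, mul_one]
    · rw [ymatU_coeff_one k p e b g (show (i : ℕ) < k by omega), hyk, mul_one, colSeq,
        dif_neg (by omega), dif_pos (by omega)]
    · rw [ymatU_coeff_one k p e b g (show 0 < (j : ℕ) from hj1), hx0, rowSeq,
        dif_neg (by omega), dif_pos (by omega)]
    · rw [ymatU_coeff_two k p e b g (show 0 < k from hk), hx0, hyk, mul_one, minorRoot_self]


end
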